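/- Suppose M is a simple Harish-Chandra module over the superconformal current algebra ĝ which is not cuspidal. Then M is a highest weight module or a lowest weight module. -/

import Mathlib

/-!
Representations of the superconformal current algebra
`ĝ = 𝔰 ⋉ (ġ ⊗ A ⊕ ℂC₁)` are encoded by the families of operators giving the
action of the basis elements `L i`, `G i`, `C`, `C₁`, `x ⊗ tⁱ` (operator `E i x`)
and `x ⊗ tⁱξ` (operator `F i x`), subject to the supercommutator relations.
-/

noncomputable section

open Module

variable (𝕘 : Type) [LieRing 𝕘] [LieAlgebra ℂ 𝕘]

/-- The operators `L, G, C, C₁, E, F` on `M` form a representation of the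
superconformal current algebra `ĝ` (with invariant form `Φ` on `ġ`):
all supercommutator relations of `ĝ` hold (commutators for pairs with at least one
even element, anticommutators for pairs of odd elements). -/
structure IsSCCRep {M : Type} [AddCommGroup M] [Module ℂ M]
    (Φ : 𝕘 →ₗ[ℂ] 𝕘 →ₗ[ℂ] ℂ)
    (L G : ℤ → End ℂ M) (C C1 : End ℂ M)
    (E F : ℤ → 𝕘 →ₗ[ℂ] End ℂ M) : Prop where
  comm_LL : ∀ i j : ℤ, L i * L j - L j * L i
      = ((j : ℂ) - (i : ℂ)) • L (i + j)
        + (if i + j = 0 then ((i : ℂ) ^ 3 - (i : ℂ)) / 12 else 0) • C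
  comm_LG : ∀ i j : ℤ, L i * G j - G j * L i = ((j : ℂ) - (i : ℂ) / 2) • G (i + j)
  comm_GG : ∀ i j : ℤ, G i * G j + G j * G i
      = (-2 : ℂ) • L (i + j)
        + (if i + j = 0 then (4 * (i : ℂ) ^ 2 - 1) / 12 else 0) • C
  comm_LE : ∀ (i j : ℤ) (x : 𝕘), L i * E j x - E j x * L i = (j : ℂ) • E (i + j) x
  comm_LF : ∀ (i j : ℤ) (x : 𝕘),
      L i * F j x - F j x * L i = ((j : ℂ) + (i : ℂ) / 2) • F (i + j) x
  comm_GE : ∀ (i j : ℤ) (x : 𝕘), G i * E j x - E j x * G i = (j : ℂ) • F (i + j) x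
  comm_GF : ∀ (i j : ℤ) (x : 𝕘), G i * F j x + F j x * G i = - E (i + j) x
  comm_EE : ∀ (i j : ℤ) (x y : 𝕘), E i x * E j y - E j y * E i x
      = E (i + j) ⁅x, y⁆ + (if i + j = 0 then (i : ℂ) * Φ x y else 0) • C1
  comm_FE : ∀ (i j : ℤ) (x y : 𝕘), F i x * E j y - E j y * F i x = F (i + j) ⁅x, y⁆
  comm_FF : ∀ (i j : ℤ) (x y : 𝕘), F i x * F j y + F j y * F i x
      = (if i + j = 0 then Φ x y else 0) • C1
  central_C_L : ∀ i, C * L i = L i * C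
  central_C_G : ∀ i, C * G i = G i * C
  central_C_E : ∀ (i : ℤ) (x : 𝕘), C * E i x = E i x * C
  central_C_F : ∀ (i : ℤ) (x : 𝕘), C * F i x = F i x * C
  central_C_C1 : C * C1 = C1 * C
  central_C1_L : ∀ i, C1 * L i = L i * C1
  central_C1_G : ∀ i, C1 * G i = G i * C1
  central_C1_E : ∀ (i : ℤ) (x : 𝕘), C1 * E i x = E i x * C1
  central_C1_F : ∀ (i : ℤ) (x : 𝕘), C1 * F i x = F i x * C1

/-- An endomorphism has parity `p` with respect to a `ℤ/2`-grading. -/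
def MapsGr {M : Type} [AddCommGroup M] [Module ℂ M]
    (gr : Fin 2 → Submodule ℂ M) (p : Fin 2) (f : End ℂ M) : Prop :=
  ∀ q, (gr q).map f ≤ gr (q + p)

/-- The grading `gr` makes `M` into a super vector space on which the operator
families act with the correct parities. -/
structure IsSCCSuper {M : Type} [AddCommGroup M] [Module ℂ M]
    (gr : Fin 2 → Submodule ℂ M)
    (L G : ℤ → End ℂ M) (C C1 : End ℂ M)
    (E F : ℤ → 𝕘 →ₗ[ℂ] End ℂ M) : Prop where
  internal : DirectSum.IsInternal gr
  hL : ∀ i, MapsGr gr 0 (L i)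
  hG : ∀ i, MapsGr gr 1 (G i)
  hC : MapsGr gr 0 C
  hC1 : MapsGr gr 0 C1
  hE : ∀ (i : ℤ) (x : 𝕘), MapsGr gr 0 (E i x)
  hF : ∀ (i : ℤ) (x : 𝕘), MapsGr gr 1 (F i x)

/-- `M` is a weight module: `L₀` acts diagonalizably. -/
def IsWeightMod {M : Type} [AddCommGroup M] [Module ℂ M] (L0 : End ℂ M) : Prop :=
  ⨆ μ : ℂ, L0.eigenspace μ = ⊤

/-- `M` is a Harish-Chandra module: a weight module with finite-dimensional
weight spaces. -/
def IsHarishChandra {M : Type} [AddCommGroup M] [Module ℂ M] (L0 : End ℂ M) : Prop :=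
  IsWeightMod L0 ∧ ∀ μ : ℂ, FiniteDimensional ℂ (L0.eigenspace μ)

/-- `M` is cuspidal (uniformly bounded): a weight module whose weight space
dimensions admit a uniform finite bound. -/
def IsCuspidalMod {M : Type} [AddCommGroup M] [Module ℂ M] (L0 : End ℂ M) : Prop :=
  IsWeightMod L0 ∧ ∃ N : ℕ, ∀ μ : ℂ, Module.rank ℂ (L0.eigenspace μ) ≤ N

/-- The set of all operators in the image of the representation. -/
def sccOps {M : Type} [AddCommGroup M] [Module ℂ M]
    (L G : ℤ → End ℂ M) (C C1 : End ℂ M)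
    (E F : ℤ → 𝕘 →ₗ[ℂ] End ℂ M) : Set (End ℂ M) :=
  Set.range L ∪ Set.range G ∪ {C, C1}
    ∪ {f | ∃ (i : ℤ) (x : 𝕘), f = E i x} ∪ {f | ∃ (i : ℤ) (x : 𝕘), f = F i x}

/-- A subspace is invariant under a set of operators. -/
def InvariantUnder {M : Type} [AddCommGroup M] [Module ℂ M]
    (S : Set (End ℂ M)) (N : Submodule ℂ M) : Prop :=
  ∀ f ∈ S, N.map f ≤ N

/-- A subspace is graded (homogeneous) with respect to the grading `gr`. -/
def GradedSub {M : Type} [AddCommGroup M] [Module ℂ M]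
    (gr : Fin 2 → Submodule ℂ M) (N : Submodule ℂ M) : Prop :=
  N ≤ (N ⊓ gr 0) ⊔ (N ⊓ gr 1)

/-- Simplicity: `M ≠ 0` and the only graded subspaces invariant under all the
operators are `0` and `M`. -/
def IsSimpleRep {M : Type} [AddCommGroup M] [Module ℂ M]
    (S : Set (End ℂ M)) (gr : Fin 2 → Submodule ℂ M) : Prop :=
  (∃ v : M, v ≠ 0) ∧
    ∀ N : Submodule ℂ M, InvariantUnder S N → GradedSub gr N → N = ⊥ ∨ N = ⊤

/-- The root space of `χ : H → ℂ` for a subalgebra `H ≤ ġ`: simultaneous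
eigenvectors for the adjoint action of `H`. -/
def rootSp {𝕘 : Type} [LieRing 𝕘] [LieAlgebra ℂ 𝕘]
    (H : LieSubalgebra ℂ 𝕘) (χ : H → ℂ) : Submodule ℂ 𝕘 where
  carrier := {x : 𝕘 | ∀ h : H, ⁅(h : 𝕘), x⁆ = χ h • x}
  add_mem' := by
    intro a b ha hb h
    rw [lie_add, ha h, hb h, smul_add]
  zero_mem' := by
    intro h
    rw [lie_zero, smul_zero]
  smul_mem' := by
    intro c a ha h
    rw [lie_smul, ha h, smul_comm]

/-- `P` is a system of positive roots for the Cartan subalgebra `H` of `ġ`. -/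
def IsPositiveSystem {𝕘 : Type} [LieRing 𝕘] [LieAlgebra ℂ 𝕘]
    (H : LieSubalgebra ℂ 𝕘) (P : Set (H → ℂ)) : Prop :=
  (∀ χ ∈ P, χ ≠ 0 ∧ rootSp H χ ≠ ⊥) ∧
  (∀ χ : H → ℂ, χ ≠ 0 → rootSp H χ ≠ ⊥ → ((χ ∈ P ∨ -χ ∈ P) ∧ ¬(χ ∈ P ∧ -χ ∈ P))) ∧
  (∀ χ ψ : H → ℂ, χ ∈ P → ψ ∈ P → rootSp H (χ + ψ) ≠ ⊥ → χ + ψ ∈ P)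

/-- `M` is a highest weight module over `ĝ`: it is generated by a nonzero vector `v₀`
annihilated by `ĝ₊ ⊕ ġ₊` which is an eigenvector for the Cartan subalgebra
`ĥ = ḣ ⊕ ℂC ⊕ ℂC₁ ⊕ ℂL₀`. -/
def IsHighestWeight (𝕘 : Type) [LieRing 𝕘] [LieAlgebra ℂ 𝕘]
    {M : Type} [AddCommGroup M] [Module ℂ M]
    (L G : ℤ → End ℂ M) (C C1 : End ℂ M)
    (E F : ℤ → 𝕘 →ₗ[ℂ] End ℂ M) : Prop :=
  ∃ (H : LieSubalgebra ℂ 𝕘), H.IsCartanSubalgebra ∧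
    ∃ P : Set (H → ℂ), IsPositiveSystem H P ∧
      ∃ v₀ : M, v₀ ≠ 0 ∧
        (∀ i : ℤ, 0 < i →
          L i v₀ = 0 ∧ G i v₀ = 0 ∧ ∀ x : 𝕘, E i x v₀ = 0 ∧ F i x v₀ = 0) ∧
        (∀ χ ∈ P, ∀ x ∈ rootSp H χ, E 0 x v₀ = 0) ∧
        (∀ h : H, ∃ c : ℂ, E 0 (h : 𝕘) v₀ = c • v₀) ∧
        (∃ c : ℂ, L 0 v₀ = c • v₀) ∧ (∃ c : ℂ, C v₀ = c • v₀) ∧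
        (∃ c : ℂ, C1 v₀ = c • v₀) ∧
        (∀ N : Submodule ℂ M,
          InvariantUnder (sccOps 𝕘 L G C C1 E F) N → v₀ ∈ N → N = ⊤)

/-- `M` is a lowest weight module over `ĝ` (defined dually). -/
def IsLowestWeight (𝕘 : Type) [LieRing 𝕘] [LieAlgebra ℂ 𝕘]
    {M : Type} [AddCommGroup M] [Module ℂ M]
    (L G : ℤ → End ℂ M) (C C1 : End ℂ M)
    (E F : ℤ → 𝕘 →ₗ[ℂ] End ℂ M) : Prop :=
  ∃ (H : LieSubalgebra ℂ 𝕘), H.IsCartanSubalgebra ∧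
    ∃ P : Set (H → ℂ), IsPositiveSystem H P ∧
      ∃ v₀ : M, v₀ ≠ 0 ∧
        (∀ i : ℤ, i < 0 →
          L i v₀ = 0 ∧ G i v₀ = 0 ∧ ∀ x : 𝕘, E i x v₀ = 0 ∧ F i x v₀ = 0) ∧
        (∀ χ ∈ P, ∀ x ∈ rootSp H (-χ), E 0 x v₀ = 0) ∧
        (∀ h : H, ∃ c : ℂ, E 0 (h : 𝕘) v₀ = c • v₀) ∧
        (∃ c : ℂ, L 0 v₀ = c • v₀) ∧ (∃ c : ℂ, C v₀ = c • v₀) ∧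
        (∃ c : ℂ, C1 v₀ = c • v₀) ∧
        (∀ N : Submodule ℂ M,
          InvariantUnder (sccOps 𝕘 L G C C1 E F) N → v₀ ∈ N → N = ⊤)

/-- Labels for the homogeneous generators of the superconformal current algebra:
the Virasoro family, the odd Neveu–Schwarz family, and the two current families. -/
inductive SCCGen (𝔞 : Type)
  | vir : SCCGen 𝔞
  | ns : SCCGen 𝔞
  | even (x : 𝔞) : SCCGen 𝔞
  | odd (x : 𝔞) : SCCGen 𝔞

section Representation

variable {𝕘} {M : Type} [AddCommGroup M] [Module ℂ M]
  {Φ : 𝕘 →ₗ[ℂ] 𝕘 →ₗ[ℂ] ℂ} {L G : ℤ → End ℂ M} {C C1 : End ℂ M}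
  {E F : ℤ → 𝕘 →ₗ[ℂ] End ℂ M}

/-- The operator of degree `i` attached to a generator label. -/
def sccOp (L G : ℤ → End ℂ M) (E F : ℤ → 𝕘 →ₗ[ℂ] End ℂ M) : SCCGen 𝕘 → ℤ → End ℂ M
  | .vir, i => L i
  | .ns, i => G i
  | .even x, i => E i x
  | .odd x, i => F i x

/-- The supercommutator of two generators whose degrees do not cancel is a multiple of a
generator. -/
lemma IsSCCRep.exists_superbracket (h : IsSCCRep 𝕘 Φ L G C C1 E F) (a b : SCCGen 𝕘)
    {i j : ℤ} (hij : i + j ≠ 0) :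
    ∃ (ε c : ℂ) (d : SCCGen 𝕘), sccOp L G E F a i * sccOp L G E F b j
      = ε • (sccOp L G E F b j * sccOp L G E F a i) + c • sccOp L G E F d (i + j) := by
  have hji : j + i = i + j := add_comm _ _
  rcases a with _ | _ | x | x <;> rcases b with _ | _ | y | y <;> simp only [sccOp]
  · refine ⟨1, (j : ℂ) - i, .vir, sub_eq_iff_eq_add'.1 ?_⟩
    simpa [hij] using h.comm_LL i j
  · refine ⟨1, (j : ℂ) - i / 2, .ns, sub_eq_iff_eq_add'.1 ?_⟩
    simpa using h.comm_LG i j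
  · refine ⟨1, j, .even y, sub_eq_iff_eq_add'.1 ?_⟩
    simpa using h.comm_LE i j y
  · refine ⟨1, (j : ℂ) + i / 2, .odd y, sub_eq_iff_eq_add'.1 ?_⟩
    simpa using h.comm_LF i j y
  · refine ⟨1, -((i : ℂ) - j / 2), .ns, sub_eq_iff_eq_add'.1 ?_⟩
    have := h.comm_LG j i
    rw [hji] at this
    rw [one_smul, neg_smul, ← this, neg_sub]
  · refine ⟨-1, -2, .vir, sub_eq_iff_eq_add'.1 ?_⟩
    simpa [hij] using h.comm_GG i j
  · refine ⟨1, j, .odd y, sub_eq_iff_eq_add'.1 ?_⟩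
    simpa using h.comm_GE i j y
  · refine ⟨-1, -1, .even y, sub_eq_iff_eq_add'.1 ?_⟩
    simpa [sccOp] using h.comm_GF i j y
  · refine ⟨1, -(i : ℂ), .even x, sub_eq_iff_eq_add'.1 ?_⟩
    have := h.comm_LE j i x
    rw [hji] at this
    rw [one_smul, neg_smul, ← this, neg_sub]
  · refine ⟨1, -(i : ℂ), .odd x, sub_eq_iff_eq_add'.1 ?_⟩
    have := h.comm_GE j i x
    rw [hji] at this
    rw [one_smul, neg_smul, ← this, neg_sub]
  · refine ⟨1, 1, .even ⁅x, y⁆, sub_eq_iff_eq_add'.1 ?_⟩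
    simpa [sccOp, hij] using h.comm_EE i j x y
  · refine ⟨1, -1, .odd ⁅y, x⁆, sub_eq_iff_eq_add'.1 ?_⟩
    have := h.comm_FE j i y x
    rw [hji] at this
    rw [one_smul, neg_smul, one_smul]
    exact (neg_sub _ _).symm.trans (congrArg _ this)
  · refine ⟨1, -((i : ℂ) + j / 2), .odd x, sub_eq_iff_eq_add'.1 ?_⟩
    have := h.comm_LF j i x
    rw [hji] at this
    rw [one_smul, neg_smul, ← this, neg_sub]
  · refine ⟨-1, -1, .even x, sub_eq_iff_eq_add'.1 ?_⟩
    have := h.comm_GF j i x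
    rw [hji] at this
    simpa [sccOp, add_comm] using this
  · refine ⟨1, 1, .odd ⁅x, y⁆, sub_eq_iff_eq_add'.1 ?_⟩
    simpa [sccOp] using h.comm_FE i j x y
  · refine ⟨-1, 0, .vir, sub_eq_iff_eq_add'.1 ?_⟩
    simpa [hij] using h.comm_FF i j x y

/-- If `v` is killed by a degree `i` generator and by all generators of degree `i + j`, then
its image under any degree `j` generator is killed by the degree `i` generator. -/
lemma IsSCCRep.op_op_eq_zero (h : IsSCCRep 𝕘 Φ L G C C1 E F) {a b : SCCGen 𝕘}
    {i j : ℤ} (hij : i + j ≠ 0) {v : M} (hv : sccOp L G E F a i v = 0)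
    (hv' : ∀ d, sccOp L G E F d (i + j) v = 0) :
    sccOp L G E F a i (sccOp L G E F b j v) = 0 := by
  obtain ⟨ε, c, d, hd⟩ := h.exists_superbracket a b hij
  simpa [hv, hv'] using LinearMap.congr_fun hd v

/-- Odd generators of degree `i ≠ 0` square to a multiple of a degree `2 i` generator. -/
lemma IsSCCRep.op_sq_eq_zero (h : IsSCCRep 𝕘 Φ L G C C1 E F) {a : SCCGen 𝕘}
    (ha : a = .ns ∨ ∃ x, a = .odd x) {i : ℤ} (hi : i ≠ 0) {v : M}
    (hv : ∀ d, sccOp L G E F d (i + i) v = 0) :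
    sccOp L G E F a i (sccOp L G E F a i v) = 0 := by
  have hi' : i + i ≠ 0 := by omega
  rcases ha with rfl | ⟨x, rfl⟩
  · have h1 := LinearMap.congr_fun (h.comm_GG i i) v
    have h2 : L (i + i) v = 0 := hv .vir
    simpa [hi', h2, sccOp, ← two_smul ℂ, hi] using h1
  · have h1 := LinearMap.congr_fun (h.comm_FF i i x x) v
    simpa [hi', sccOp, ← two_smul ℂ, hi] using h1

lemma IsSCCRep.comm_L0 (h : IsSCCRep 𝕘 Φ L G C C1 E F) (a : SCCGen 𝕘) (i : ℤ) :
    L 0 * sccOp L G E F a i - sccOp L G E F a i * L 0 = (i : ℂ) • sccOp L G E F a i := by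
  rcases a with _ | _ | x | x
  · have := h.comm_LL 0 i
    simpa [sccOp] using this
  · simpa [sccOp] using h.comm_LG 0 i
  · simpa [sccOp] using h.comm_LE 0 i x
  · simpa [sccOp] using h.comm_LF 0 i x

/-- A generator of degree `i` maps the weight space of `μ` to that of `μ + i`. -/
lemma IsSCCRep.op_mem_eigenspace (h : IsSCCRep 𝕘 Φ L G C C1 E F) (a : SCCGen 𝕘) (i : ℤ)
    {μ : ℂ} {v : M} (hv : v ∈ (L 0).eigenspace μ) :
    sccOp L G E F a i v ∈ (L 0).eigenspace (μ + i) := by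
  rw [Module.End.mem_eigenspace_iff] at hv ⊢
  have h1 := LinearMap.congr_fun (h.comm_L0 a i) v
  simp only [LinearMap.sub_apply, Module.End.mul_apply, hv, map_smul,
    LinearMap.smul_apply] at h1
  rw [add_smul, ← h1, add_sub_cancel]

/-- Even generators of positive degree have nonzero commutators with Virasoro operators of
negative degree, of the same type. -/
lemma IsSCCRep.exists_comm_L (h : IsSCCRep 𝕘 Φ L G C C1 E F) {a : SCCGen 𝕘}
    (ha : a = .vir ∨ ∃ x, a = .even x) {i j : ℤ} (hi : 0 < i) (hj : j < 0)
    (hij : i + j ≠ 0) :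
    ∃ c : ℂ, c ≠ 0 ∧ sccOp L G E F a i * L j
      = L j * sccOp L G E F a i + c • sccOp L G E F a (i + j) := by
  rcases ha with rfl | ⟨x, rfl⟩
  · refine ⟨(j : ℂ) - i, ?_, sub_eq_iff_eq_add'.1 ?_⟩
    · rw [sub_ne_zero]
      exact_mod_cast (by omega : j ≠ i)
    · simpa [sccOp, hij] using h.comm_LL i j
  · refine ⟨-(i : ℂ), ?_, sub_eq_iff_eq_add'.1 ?_⟩
    · exact neg_ne_zero.2 (by exact_mod_cast hi.ne')
    · have := h.comm_LE j i x
      rw [add_comm j i] at this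
      simp only [sccOp, neg_smul, ← this, neg_sub]

/-- All generators of degree larger than `N` annihilate `v`. -/
def KilledAbove (L G : ℤ → End ℂ M) (E F : ℤ → 𝕘 →ₗ[ℂ] End ℂ M) (N : ℤ) (v : M) : Prop :=
  ∀ n, N < n → ∀ a, sccOp L G E F a n v = 0

lemma KilledAbove.op (h : IsSCCRep 𝕘 Φ L G C C1 E F) {N : ℤ} (hN : 0 ≤ N) {v : M}
    (hv : KilledAbove L G E F N v) (b : SCCGen 𝕘) {j : ℤ} (hj : 0 ≤ j) :
    KilledAbove L G E F N (sccOp L G E F b j v) := fun n hn a ↦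
  h.op_op_eq_zero (by omega) (hv n hn a) fun d ↦ hv (n + j) (by omega) d

lemma KilledAbove.op_pow (h : IsSCCRep 𝕘 Φ L G C C1 E F) {N : ℤ} (hN : 0 ≤ N) {v : M}
    (hv : KilledAbove L G E F N v) (b : SCCGen 𝕘) {j : ℤ} (hj : 0 ≤ j) (k : ℕ) :
    KilledAbove L G E F N ((sccOp L G E F b j ^ k) v) := by
  induction k with
  | zero => simpa using hv
  | succ k ih => rw [pow_succ', Module.End.mul_apply]; exact ih.op h hN b hj

lemma IsSCCRep.op_pow_mem_eigenspace (h : IsSCCRep 𝕘 Φ L G C C1 E F) (a : SCCGen 𝕘) (i : ℤ)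
    {μ : ℂ} {v : M} (hv : v ∈ (L 0).eigenspace μ) (k : ℕ) :
    (sccOp L G E F a i ^ k) v ∈ (L 0).eigenspace (μ + k * i) := by
  induction k with
  | zero => simpa using hv
  | succ k ih =>
    rw [pow_succ', Module.End.mul_apply]
    convert h.op_mem_eigenspace a i ih using 2
    push_cast; ring

/-- A sequence of vectors on which a sequence of operators is triangular with nonzero diagonal
is linearly independent. -/
lemma linearIndependent_of_triangular {V W : Type*} [AddCommGroup V] [Module ℂ V]
    [AddCommGroup W] [Module ℂ W] (w : ℕ → V) (U : ℕ → V →ₗ[ℂ] W)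
    (h0 : ∀ k K, k < K → U K (w k) = 0) (h1 : ∀ K, U K (w K) ≠ 0) :
    LinearIndependent ℂ w := by
  rw [linearIndependent_iff']
  intro s g hg
  by_contra! hne
  obtain ⟨i, his, hi⟩ := hne
  have ht : (s.filter fun i ↦ g i ≠ 0).Nonempty := ⟨i, by simp [his, hi]⟩
  set K := (s.filter fun i ↦ g i ≠ 0).max' ht with hK
  have hKm := Finset.max'_mem _ ht
  rw [← hK, Finset.mem_filter] at hKm
  have h2 := congrArg (U K) hg
  rw [map_sum, map_zero, Finset.sum_eq_single K] at h2
  · rw [map_smul, smul_eq_zero] at h2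
    exact h2.elim hKm.2 (h1 K)
  · intro k hk hkK
    rcases lt_or_gt_of_ne hkK with hlt | hgt
    · rw [map_smul, h0 k K hlt, smul_zero]
    · have : g k = 0 := by
        by_contra hgk
        exact absurd (Finset.le_max' _ k (Finset.mem_filter.2 ⟨hk, hgk⟩)) (not_le.2 hgt)
      rw [this, zero_smul, map_zero]
  · exact fun hh ↦ absurd hKm.1 hh

/-- On a weight vector killed above degree `N > 0`, generators of degree `N` act nilpotently,
provided the weight space is finite-dimensional. -/
lemma KilledAbove.exists_pow_eq_zero (h : IsSCCRep 𝕘 Φ L G C C1 E F) {N : ℤ} (hN : 0 < N)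
    {μ : ℂ} [FiniteDimensional ℂ ((L 0).eigenspace μ)] {v : M}
    (hμ : v ∈ (L 0).eigenspace μ) (hv : KilledAbove L G E F N v) (a : SCCGen 𝕘) :
    ∃ k : ℕ, (sccOp L G E F a N ^ k) v = 0 := by
  by_cases ha : a = .ns ∨ ∃ x, a = .odd x
  · exact ⟨2, by simpa [pow_two] using h.op_sq_eq_zero ha hN.ne' fun d ↦ hv _ (by omega) d⟩
  replace ha : a = .vir ∨ ∃ x, a = .even x := by rcases a <;> simp_all
  by_contra! hne
  set T := sccOp L G E F a N with hT
  let w : ℕ → M := fun k ↦ L (-((k + 1 : ℕ) * N)) ((T ^ (k + 1)) v)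
  have hw : ∀ k, w k ∈ (L 0).eigenspace μ := fun k ↦ by
    have := h.op_mem_eigenspace .vir (-((k + 1 : ℕ) * N)) (h.op_pow_mem_eigenspace a N hμ (k + 1))
    have e : μ + (k + 1 : ℕ) * N + ((-((k + 1 : ℕ) * N) : ℤ) : ℂ) = μ := by push_cast; ring
    rw [e] at this
    exact this
  have hU : ∀ k K : ℕ, k ≤ K → ∃ c : ℂ, c ≠ 0 ∧
      sccOp L G E F a ((K + 2 : ℕ) * N) (w k)
        = c • sccOp L G E F a ((K - k + 1 : ℕ) * N) ((T ^ (k + 1)) v) := by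
    intro k K hk
    have e : ((K + 2 : ℕ) : ℤ) * N + -((k + 1 : ℕ) * N) = ((K - k + 1 : ℕ) : ℤ) * N := by
      push_cast [hk]; ring
    obtain ⟨c, hc, hcomm⟩ := h.exists_comm_L ha (i := (K + 2 : ℕ) * N)
      (j := -((k + 1 : ℕ) * N)) (by positivity) (neg_lt_zero.2 (by positivity))
      (by rw [e]; positivity)
    refine ⟨c, hc, ?_⟩
    have h3 := LinearMap.congr_fun hcomm ((T ^ (k + 1)) v)
    have h4 := hv.op_pow h hN.le a hN.le (k + 1) ((K + 2 : ℕ) * N) (by push_cast; nlinarith) a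
    rw [← hT] at h4
    simpa only [e, Module.End.mul_apply, LinearMap.add_apply, LinearMap.smul_apply, h4, map_zero,
      zero_add] using h3
  have hli : LinearIndependent ℂ w := by
    refine linearIndependent_of_triangular w (fun K ↦ sccOp L G E F a ((K + 2 : ℕ) * N)) ?_ ?_
    · intro k K hkK
      obtain ⟨c, -, hc⟩ := hU k K hkK.le
      rw [hc, hv.op_pow h hN.le a hN.le (k + 1) _ ?_ a, smul_zero]
      have : (1 : ℤ) ≤ ((K - k : ℕ) : ℤ) := by omega
      push_cast [hkK.le] at this ⊢; nlinarith
    · intro K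
      obtain ⟨c, hc0, hc⟩ := hU K K le_rfl
      rw [hc]
      refine smul_ne_zero hc0 ?_
      have := hne (K + 2)
      rw [pow_succ', Module.End.mul_apply] at this
      simpa [hT] using this
  have hli' : LinearIndependent ℂ (fun k ↦ (⟨w k, hw k⟩ : (L 0).eigenspace μ)) :=
    LinearIndependent.of_comp ((L 0).eigenspace μ).subtype hli
  exact not_finite_iff_infinite.2 inferInstance hli'.finite

/-- A finite list of labels spanning all generators of a given degree. -/
def sccGenList (𝕘 : Type) [LieRing 𝕘] [LieAlgebra ℂ 𝕘] [FiniteDimensional ℂ 𝕘] :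
    List (SCCGen 𝕘) :=
  [.vir, .ns] ++ (List.finRange _).map (fun i ↦ .even (Module.finBasis ℂ 𝕘 i))
    ++ (List.finRange _).map fun i ↦ .odd (Module.finBasis ℂ 𝕘 i)

lemma sccOp_eq_zero_of_forall_mem_sccGenList [FiniteDimensional ℂ 𝕘] {n : ℤ} {v : M}
    (hv : ∀ a ∈ sccGenList 𝕘, sccOp L G E F a n v = 0) (a : SCCGen 𝕘) :
    sccOp L G E F a n v = 0 := by
  let B := Module.finBasis ℂ 𝕘
  rcases a with _ | _ | x | x
  · exact hv _ (by simp [sccGenList])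
  · exact hv _ (by simp [sccGenList])
  · have : (E n).flip v = 0 := B.ext fun i ↦ hv (.even (B i)) (by simp [sccGenList, B])
    exact LinearMap.congr_fun this x
  · have : (F n).flip v = 0 := B.ext fun i ↦ hv (.odd (B i)) (by simp [sccGenList, B])
    exact LinearMap.congr_fun this x

/-- A weight vector killed by all generators of large degree produces, by descending
induction on the degree, a weight vector killed by all generators of positive degree. -/
lemma exists_killedAbove_zero [FiniteDimensional ℂ 𝕘]
    (h : IsSCCRep 𝕘 Φ L G C C1 E F)
    (hfd : ∀ μ, FiniteDimensional ℂ ((L 0).eigenspace μ)) (N : ℕ)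
    (hN : ∃ μ, ∃ v ∈ (L 0).eigenspace μ, v ≠ 0 ∧ KilledAbove L G E F N v) :
    ∃ μ, ∃ v ∈ (L 0).eigenspace μ, v ≠ 0 ∧ KilledAbove L G E F 0 v := by
  induction N with
  | zero => simpa using hN
  | succ N ih =>
    apply ih
    have hpos : (0 : ℤ) < (N + 1 : ℕ) := by positivity
    have key : ∀ s : List (SCCGen 𝕘), ∃ μ, ∃ v ∈ (L 0).eigenspace μ, v ≠ 0 ∧
        KilledAbove L G E F (N + 1 : ℕ) v ∧ ∀ a ∈ s, sccOp L G E F a (N + 1 : ℕ) v = 0 := by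
      intro s
      induction s with
      | nil => simpa using hN
      | cons a s ihs =>
        obtain ⟨μ, v, hμ, hv0, hk, hs⟩ := ihs
        have := hfd μ
        have hex := hk.exists_pow_eq_zero h hpos hμ a
        classical
        have hspec := Nat.find_spec hex
        have hmin := fun m ↦ Nat.find_min hex (m := m)
        obtain ⟨m, hm⟩ : ∃ m, Nat.find hex = m + 1 :=
          Nat.exists_eq_succ_of_ne_zero fun h0 ↦ hv0 (by simpa [h0] using hspec)
        rw [hm] at hspec hmin
        refine ⟨_, _, h.op_pow_mem_eigenspace a (N + 1 : ℕ) hμ m, hmin m (by omega),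
          hk.op_pow h hpos.le a hpos.le m, ?_⟩
        have hs' : ∀ k : ℕ, ∀ b ∈ s,
            sccOp L G E F b (N + 1 : ℕ) ((sccOp L G E F a (N + 1 : ℕ) ^ k) v) = 0 := by
          intro k b hb
          induction k with
          | zero => simpa using hs b hb
          | succ k ihk =>
            rw [pow_succ', Module.End.mul_apply]
            exact h.op_op_eq_zero (by omega) ihk
              fun d ↦ hk.op_pow h hpos.le a hpos.le k _ (by omega) d
        intro b hb
        rcases List.mem_cons.1 hb with rfl | hb
        · simpa [pow_succ'] using hspec
        · exact hs' m b hb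
    obtain ⟨μ, v, hμ, hv0, hk, hs⟩ := key (sccGenList 𝕘)
    refine ⟨μ, v, hμ, hv0, fun n hn a ↦ ?_⟩
    rcases eq_or_lt_of_le (by omega : ((N + 1 : ℕ) : ℤ) ≤ n) with rfl | hlt
    · exact sccOp_eq_zero_of_forall_mem_sccGenList hs a
    · exact hk n hlt a

/-- Commutators of a generator of degree `i > 0` with Virasoro operators of large degree
are nonzero multiples of generators of the same type. -/
lemma IsSCCRep.exists_L_comm (h : IsSCCRep 𝕘 Φ L G C C1 E F) (a : SCCGen 𝕘) {i j : ℤ}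
    (hi : 0 < i) (hij : 2 * i < j) :
    ∃ c : ℂ, c ≠ 0 ∧
      L j * sccOp L G E F a i - sccOp L G E F a i * L j = c • sccOp L G E F a (j + i) := by
  have hne : j + i ≠ 0 := by omega
  rcases a with _ | _ | x | x
  · refine ⟨(i : ℂ) - j, ?_, by simpa [sccOp, hne] using h.comm_LL j i⟩
    rw [sub_ne_zero]
    exact_mod_cast (by omega : i ≠ j)
  · refine ⟨(i : ℂ) - j / 2, ?_, h.comm_LG j i⟩
    intro h0
    have h1 : (2 * i : ℂ) = j := by linear_combination 2 * h0
    exact hij.ne (by exact_mod_cast h1)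
  · exact ⟨i, by exact_mod_cast hi.ne', h.comm_LE j i x⟩
  · refine ⟨(i : ℂ) + j / 2, ?_, h.comm_LF j i x⟩
    intro h0
    have h1 : (2 * i + j : ℂ) = 0 := by linear_combination 2 * h0
    have h2 : 2 * i + j = 0 := by exact_mod_cast h1
    omega

/-- A vector killed by all generators of two consecutive positive degrees is killed by all
generators of large degree. -/
lemma IsSCCRep.exists_killedAbove (h : IsSCCRep 𝕘 Φ L G C C1 E F) {k : ℤ} (hk : 0 < k) {v : M}
    (h1 : ∀ a, sccOp L G E F a k v = 0) (h2 : ∀ a, sccOp L G E F a (k + 1) v = 0) :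
    ∃ N : ℕ, KilledAbove L G E F N v := by
  have hadd : ∀ i j : ℤ, 0 < i → i < j → L i v = 0 → L j v = 0 → L (j + i) v = 0 := by
    intro i j hi hij hLi hLj
    have hne : j + i ≠ 0 := by omega
    have h3 := LinearMap.congr_fun (h.comm_LL i j) v
    have h4 : (j : ℂ) - i ≠ 0 := by
      rw [sub_ne_zero]; exact_mod_cast hij.ne'
    simpa [hne, hLi, hLj, h4, add_comm i j] using h3.symm
  have hcomb : ∀ a b : ℕ, L ((a + 1) * k + (b + 1) * (k + 1)) v = 0 := by
    intro a b
    induction a with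
    | zero =>
      induction b with
      | zero =>
        convert hadd k (k + 1) hk (by omega) (h1 .vir) (h2 .vir) using 3
        push_cast; ring
      | succ b ih =>
        convert hadd (k + 1) _ (by omega) ?_ (h2 .vir) ih using 3
        · push_cast; ring
        · push_cast; nlinarith
    | succ a ih =>
      convert hadd k _ hk ?_ (h1 .vir) ih using 3
      · push_cast; ring
      · nlinarith [mul_nonneg (Int.natCast_nonneg a) hk.le,
          mul_nonneg (Int.natCast_nonneg b) (by omega : 0 ≤ k + 1)]
  have hL : ∀ n, k * (k + 1) < n → L n v = 0 := by
    intro n hn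
    have hq : k + 1 ≤ (n - 1) / k := (Int.le_ediv_iff_mul_le hk).2 (by nlinarith)
    have hr0 := Int.emod_nonneg (n - 1) hk.ne'
    have hr1 := Int.emod_lt_of_pos (n - 1) hk
    have hqr := Int.mul_ediv_add_emod (n - 1) k
    set q := (n - 1) / k
    set r := (n - 1) % k
    have h3 := hcomb (q - r - 2).toNat r.toNat
    rw [Int.toNat_of_nonneg (by omega), Int.toNat_of_nonneg hr0] at h3
    convert h3 using 3
    linear_combination -hqr
  refine ⟨(k * (k + 1) + 3 * k).toNat, fun n hn a ↦ ?_⟩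
  rw [Int.toNat_of_nonneg (by positivity)] at hn
  obtain ⟨c, hc, hcomm⟩ := h.exists_L_comm a hk (j := n - k) (by nlinarith)
  have h3 := LinearMap.congr_fun hcomm v
  rw [sub_add_cancel] at h3
  simpa [h1, hL (n - k) (by linarith), hc] using h3.symm

/-- Finitely many operators mapping a large finite-dimensional space to a fixed one have
a common kernel vector. -/
lemma exists_ne_zero_forall_apply_eq_zero {ι : Type*} [Fintype ι] (V W : Submodule ℂ M)
    [FiniteDimensional ℂ V] [FiniteDimensional ℂ W] (f : ι → End ℂ M)
    (hf : ∀ i, ∀ v ∈ V, f i v ∈ W)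
    (hlt : Fintype.card ι * finrank ℂ W < finrank ℂ V) :
    ∃ v ∈ V, v ≠ 0 ∧ ∀ i, f i v = 0 := by
  let T : V →ₗ[ℂ] (ι → W) := LinearMap.pi fun i ↦ (f i).restrict (hf i)
  have hker : LinearMap.ker T ≠ ⊥ := by
    apply LinearMap.ker_ne_bot_of_finrank_lt
    rwa [finrank_pi_fintype, Finset.sum_const, Finset.card_univ, smul_eq_mul]
  obtain ⟨v, hv, hv0⟩ := (Submodule.ne_bot_iff _).1 hker
  refine ⟨v, v.2, by simpa using hv0, fun i ↦ ?_⟩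
  have := congrFun (LinearMap.mem_ker.1 hv) i
  simpa [T] using congrArg Subtype.val this

/-- If a weight space is large compared with a fixed subspace containing its images under
generators of degrees `m` and `n`, it contains a nonzero vector killed by those generators. -/
lemma exists_killed_of_finrank_lt [FiniteDimensional ℂ 𝕘] (V W : Submodule ℂ M)
    [FiniteDimensional ℂ V] [FiniteDimensional ℂ W] {m n : ℤ}
    (hm : ∀ a, ∀ v ∈ V, sccOp L G E F a m v ∈ W) (hn : ∀ a, ∀ v ∈ V, sccOp L G E F a n v ∈ W)
    (hlt : (sccGenList 𝕘).length * 2 * finrank ℂ W < finrank ℂ V) :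
    ∃ v ∈ V, v ≠ 0 ∧ (∀ a, sccOp L G E F a m v = 0) ∧ ∀ a, sccOp L G E F a n v = 0 := by
  let f : Fin (sccGenList 𝕘).length × Bool → End ℂ M :=
    fun p ↦ sccOp L G E F ((sccGenList 𝕘).get p.1) (cond p.2 m n)
  obtain ⟨v, hv, hv0, hfv⟩ := exists_ne_zero_forall_apply_eq_zero V W f
    (by rintro ⟨i, _ | _⟩ v hv; exacts [hn _ v hv, hm _ v hv]) (by simpa using hlt)
  refine ⟨v, hv, hv0, sccOp_eq_zero_of_forall_mem_sccGenList fun a ha ↦ ?_,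
    sccOp_eq_zero_of_forall_mem_sccGenList fun a ha ↦ ?_⟩
  · obtain ⟨i, rfl⟩ := List.get_of_mem ha
    exact hfv (i, true)
  · obtain ⟨i, rfl⟩ := List.get_of_mem ha
    exact hfv (i, false)

/-- The operators in the image of the representation are the generators and the two central
operators. -/
lemma eq_sccOp_or_of_mem_sccOps {f : End ℂ M} (hf : f ∈ sccOps 𝕘 L G C C1 E F) :
    (∃ a i, f = sccOp L G E F a i) ∨ f = C ∨ f = C1 := by
  rcases hf with (((⟨i, rfl⟩ | ⟨i, rfl⟩) | hf) | ⟨i, x, rfl⟩) | ⟨i, x, rfl⟩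
  · exact .inl ⟨.vir, i, rfl⟩
  · exact .inl ⟨.ns, i, rfl⟩
  · exact .inr hf
  · exact .inl ⟨.even x, i, rfl⟩
  · exact .inl ⟨.odd x, i, rfl⟩

/-- An operator commuting with `T` preserves the eigenspaces of `T`. -/
lemma apply_mem_eigenspace_of_commute {T S : End ℂ M} (hST : S * T = T * S) {μ : ℂ} {v : M}
    (hv : v ∈ T.eigenspace μ) : S v ∈ T.eigenspace μ := by
  rw [Module.End.mem_eigenspace_iff] at hv ⊢
  have := LinearMap.congr_fun hST v
  rw [Module.End.mul_apply, Module.End.mul_apply, hv, map_smul] at this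
  exact this.symm

/-- Every vector is a sum of an even and an odd vector. -/
lemma exists_add_of_isInternal {gr : Fin 2 → Submodule ℂ M} (hgr : DirectSum.IsInternal gr)
    (v : M) : ∃ v₀ ∈ gr 0, ∃ v₁ ∈ gr 1, v₀ + v₁ = v := by
  have h : v ∈ ⨆ i, gr i := by rw [hgr.submodule_iSup_eq_top]; trivial
  have hle : ⨆ i, gr i ≤ gr 0 ⊔ gr 1 :=
    iSup_le (Fin.forall_fin_two.2 ⟨le_sup_left, le_sup_right⟩)
  exact Submodule.mem_sup.1 (hle h)

lemma disjoint_of_isInternal {gr : Fin 2 → Submodule ℂ M} (hgr : DirectSum.IsInternal gr) :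
    Disjoint (gr 0) (gr 1) :=
  hgr.submodule_iSupIndep.pairwiseDisjoint (by decide)

/-- Homogeneous components of an eigenvector of an even operator are eigenvectors. -/
lemma mem_eigenspace_of_add_mem {gr : Fin 2 → Submodule ℂ M} (hgr : DirectSum.IsInternal gr)
    {T : End ℂ M} (hT : MapsGr gr 0 T) {μ : ℂ} {v₀ v₁ : M} (h₀ : v₀ ∈ gr 0) (h₁ : v₁ ∈ gr 1)
    (h : v₀ + v₁ ∈ T.eigenspace μ) : v₀ ∈ T.eigenspace μ ∧ v₁ ∈ T.eigenspace μ := by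
  have hT0 : T v₀ ∈ gr 0 := hT 0 (Submodule.mem_map_of_mem h₀)
  have hT1 : T v₁ ∈ gr 1 := hT 1 (Submodule.mem_map_of_mem h₁)
  simp only [Module.End.mem_eigenspace_iff, map_add, smul_add] at h ⊢
  have e : T v₀ - μ • v₀ = -(T v₁ - μ • v₁) := by
    rw [← sub_eq_zero] at h ⊢
    rw [← h]; abel
  have hz : T v₀ - μ • v₀ = 0 := (Submodule.disjoint_def.1 (disjoint_of_isInternal hgr)) _
    (sub_mem hT0 ((gr 0).smul_mem _ h₀))
    (by rw [e]; exact neg_mem (sub_mem hT1 ((gr 1).smul_mem _ h₁)))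
  refine ⟨sub_eq_zero.1 hz, sub_eq_zero.1 ?_⟩
  rw [hz] at e
  exact neg_eq_zero.1 e.symm

/-- Eigenspaces of even operators are graded. -/
lemma gradedSub_eigenspace {gr : Fin 2 → Submodule ℂ M} (hgr : DirectSum.IsInternal gr)
    {T : End ℂ M} (hT : MapsGr gr 0 T) (μ : ℂ) : GradedSub gr (T.eigenspace μ) := by
  intro v hv
  obtain ⟨v₀, h₀, v₁, h₁, rfl⟩ := exists_add_of_isInternal hgr v
  obtain ⟨e₀, e₁⟩ := mem_eigenspace_of_add_mem hgr hT h₀ h₁ hv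
  exact add_mem (Submodule.mem_sup_left ⟨e₀, h₀⟩) (Submodule.mem_sup_right ⟨e₁, h₁⟩)

/-- The weights of a simple module lie in a single coset of `ℤ`. -/
lemma exists_int_of_eigenspace_ne_bot (h : IsSCCRep 𝕘 Φ L G C C1 E F)
    {gr : Fin 2 → Submodule ℂ M} (hsuper : IsSCCSuper 𝕘 gr L G C C1 E F)
    (hsimple : IsSimpleRep (sccOps 𝕘 L G C C1 E F) gr) {l μ : ℂ}
    (hl : (L 0).eigenspace l ≠ ⊥) (hμ : (L 0).eigenspace μ ≠ ⊥) :
    ∃ n : ℤ, μ = l + n := by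
  by_contra! hne
  let N : Submodule ℂ M := ⨆ n : ℤ, (L 0).eigenspace (l + n)
  have hle (n : ℤ) : (L 0).eigenspace (l + n) ≤ N :=
    le_iSup (fun n : ℤ ↦ (L 0).eigenspace (l + n)) n
  have hinv : InvariantUnder (sccOps 𝕘 L G C C1 E F) N := by
    intro f hf
    rw [Submodule.map_iSup]
    refine iSup_le fun n ↦ Submodule.map_le_iff_le_comap.2 fun v hv ↦ ?_
    rcases eq_sccOp_or_of_mem_sccOps hf with ⟨a, i, rfl⟩ | rfl | rfl
    · refine hle (n + i) ?_
      have := h.op_mem_eigenspace a i hv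
      push_cast
      rwa [← add_assoc]
    · exact hle n (apply_mem_eigenspace_of_commute (h.central_C_L 0) hv)
    · exact hle n (apply_mem_eigenspace_of_commute (h.central_C1_L 0) hv)
  have hgrd : GradedSub gr N := by
    refine iSup_le fun n ↦ (gradedSub_eigenspace hsuper.internal (hsuper.hL 0) _).trans ?_
    exact sup_le_sup (inf_le_inf_right _ (hle n)) (inf_le_inf_right _ (hle n))
  rcases hsimple.2 N hinv hgrd with h0 | h1
  · exact hl (eq_bot_iff.2 (by simpa [h0] using hle 0))
  · have hd := (Module.End.eigenspaces_iSupIndep (L 0)) μ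
    have hN : N ≤ ⨆ j, ⨆ (_ : j ≠ μ), (L 0).eigenspace j :=
      iSup_le fun n ↦ le_iSup₂_of_le (l + n) (hne n).symm le_rfl
    rw [h1, top_le_iff] at hN
    rw [hN, disjoint_top] at hd
    exact hμ hd

/-- In a simple Harish-Chandra module with unbounded weight multiplicities there is a weight
vector killed by all generators in two consecutive positive, or negative, degrees. -/
lemma exists_killed_consecutive [FiniteDimensional ℂ 𝕘] (h : IsSCCRep 𝕘 Φ L G C C1 E F)
    {gr : Fin 2 → Submodule ℂ M} (hsuper : IsSCCSuper 𝕘 gr L G C C1 E F)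
    (hsimple : IsSimpleRep (sccOps 𝕘 L G C C1 E F) gr)
    (hHC : IsHarishChandra (L 0)) (hnotcusp : ¬ IsCuspidalMod (L 0)) :
    ∃ μ, ∃ v ∈ (L 0).eigenspace μ, v ≠ 0 ∧ ∃ k : ℤ, 0 < k ∧
      (((∀ a, sccOp L G E F a k v = 0) ∧ ∀ a, sccOp L G E F a (k + 1) v = 0) ∨
        ((∀ a, sccOp L G E F a (-k) v = 0) ∧ ∀ a, sccOp L G E F a (-(k + 1)) v = 0)) := by
  have hfd := hHC.2
  have hunb : ∀ B : ℕ, ∃ μ, B < finrank ℂ ((L 0).eigenspace μ) := by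
    by_contra! hB
    obtain ⟨B, hB⟩ := hB
    exact hnotcusp ⟨hHC.1, B, fun μ ↦ by
      rw [← finrank_eq_rank]; exact_mod_cast hB μ⟩
  have hnebot : ∀ {μ}, 0 < finrank ℂ ((L 0).eigenspace μ) → (L 0).eigenspace μ ≠ ⊥ := by
    intro μ hμ h0
    rw [h0, finrank_bot] at hμ
    exact hμ.false
  obtain ⟨l, hl⟩ := hunb 0
  let W (ε : ℤ) : Submodule ℂ M := (L 0).eigenspace l ⊔ (L 0).eigenspace (l + ε)
  have hWfd (ε : ℤ) : FiniteDimensional ℂ (W ε) := Submodule.finiteDimensional_sup _ _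
  have hW : ∀ ε m n : ℤ, m = -n ∨ m = -n + ε → ∀ a, ∀ v ∈ (L 0).eigenspace (l + n),
      sccOp L G E F a m v ∈ W ε := by
    intro ε m n hmn a v hv
    have hm := h.op_mem_eigenspace a m hv
    rcases hmn with rfl | rfl
    · refine Submodule.mem_sup_left ?_
      simpa using hm
    · refine Submodule.mem_sup_right ?_
      convert hm using 2
      push_cast; ring
  obtain ⟨r, hr⟩ : ∃ r, r = (sccGenList 𝕘).length * 2 := ⟨_, rfl⟩
  obtain ⟨μ, hμ⟩ := hunb (r * finrank ℂ (W 1) + r * finrank ℂ (W (-1))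
    + finrank ℂ ((L 0).eigenspace l))
  obtain ⟨n, rfl⟩ := exists_int_of_eigenspace_ne_bot h hsuper hsimple (hnebot hl)
    (hnebot (by omega : 0 < finrank ℂ ((L 0).eigenspace μ)))
  have hV := hfd (l + n)
  rcases lt_trichotomy n 0 with hn | rfl | hn
  · obtain ⟨v, hv, hv0, h1, h2⟩ := exists_killed_of_finrank_lt _ _
      (hW 1 (-n) n (.inl rfl)) (hW 1 (-n + 1) n (.inr rfl)) (by rw [← hr]; omega)
    exact ⟨_, v, hv, hv0, -n, by omega, .inl ⟨h1, h2⟩⟩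
  · rw [Int.cast_zero, add_zero] at hμ
    omega
  · obtain ⟨v, hv, hv0, h1, h2⟩ := exists_killed_of_finrank_lt _ _
      (hW (-1) (-n) n (.inl rfl)) (hW (-1) (-(n + 1)) n (.inr (by ring)))
      (by rw [← hr]; omega)
    exact ⟨_, v, hv, hv0, n, hn, .inr ⟨h1, h2⟩⟩

/-- Every generator is homogeneous with respect to the parity grading. -/
lemma IsSCCSuper.exists_mapsGr_op {gr : Fin 2 → Submodule ℂ M}
    (hsuper : IsSCCSuper 𝕘 gr L G C C1 E F) (a : SCCGen 𝕘) (i : ℤ) :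
    ∃ p, MapsGr gr p (sccOp L G E F a i) := by
  rcases a with _ | _ | x | x
  exacts [⟨0, hsuper.hL i⟩, ⟨1, hsuper.hG i⟩, ⟨0, hsuper.hE i x⟩, ⟨1, hsuper.hF i x⟩]

/-- If a homogeneous operator kills a vector, it kills its homogeneous components. -/
lemma MapsGr.apply_eq_zero_of_add {gr : Fin 2 → Submodule ℂ M} (hgr : DirectSum.IsInternal gr)
    {p : Fin 2} {f : End ℂ M} (hf : MapsGr gr p f) {v₀ v₁ : M} (h₀ : v₀ ∈ gr 0)
    (h₁ : v₁ ∈ gr 1) (h : f (v₀ + v₁) = 0) : f v₀ = 0 ∧ f v₁ = 0 := by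
  have hf0 : f v₀ ∈ gr (0 + p) := hf 0 (Submodule.mem_map_of_mem h₀)
  have hf1 : f v₁ ∈ gr (1 + p) := hf 1 (Submodule.mem_map_of_mem h₁)
  rw [map_add] at h
  have hd : Disjoint (gr (0 + p)) (gr (1 + p)) :=
    hgr.submodule_iSupIndep.pairwiseDisjoint (fun e ↦ absurd (add_right_cancel e) (by decide))
  have hz : f v₀ = 0 := Submodule.disjoint_def.1 hd _ hf0
    (by rw [eq_neg_of_add_eq_zero_left h]; exact neg_mem hf1)
  exact ⟨hz, by simpa [hz] using h⟩

/-- In a simple module every nonzero homogeneous vector generates, even when submodules are not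
required to be graded. -/
lemma IsSimpleRep.eq_top_of_mem {gr : Fin 2 → Submodule ℂ M}
    (hsuper : IsSCCSuper 𝕘 gr L G C C1 E F)
    (hsimple : IsSimpleRep (sccOps 𝕘 L G C C1 E F) gr) {p : Fin 2} {v : M} (hv0 : v ≠ 0)
    (hvp : v ∈ gr p) {N : Submodule ℂ M}
    (hN : InvariantUnder (sccOps 𝕘 L G C C1 E F) N) (hv : v ∈ N) : N = ⊤ := by
  let N' : Submodule ℂ M := (N ⊓ gr 0) ⊔ (N ⊓ gr 1)
  have hmem (q : Fin 2) : N ⊓ gr q ≤ N' := by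
    revert q; exact Fin.forall_fin_two.2 ⟨le_sup_left, le_sup_right⟩
  have hinv : InvariantUnder (sccOps 𝕘 L G C C1 E F) N' := by
    intro f hf
    obtain ⟨q, hq⟩ : ∃ q, MapsGr gr q f := by
      rcases eq_sccOp_or_of_mem_sccOps hf with ⟨a, i, rfl⟩ | rfl | rfl
      exacts [hsuper.exists_mapsGr_op a i, ⟨0, hsuper.hC⟩, ⟨0, hsuper.hC1⟩]
    have key (s : Fin 2) : (N ⊓ gr s).map f ≤ N' := by
      refine le_trans ?_ (hmem (s + q))
      exact (Submodule.map_inf_le f).trans (inf_le_inf (hN f hf) (hq s))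
    rw [Submodule.map_sup]
    exact sup_le (key 0) (key 1)
  have hgrd : GradedSub gr N' :=
    sup_le_sup (le_inf le_sup_left inf_le_right) (le_inf le_sup_right inf_le_right)
  rcases hsimple.2 N' hinv hgrd with h0 | h1
  · have : v ∈ N' := hmem p ⟨hv, hvp⟩
    rw [h0] at this
    exact absurd this hv0
  · exact top_le_iff.1 (h1 ▸ sup_le inf_le_left inf_le_left)

/-- Commuting operators preserving a nonzero finite-dimensional subspace have a joint
eigenvector in it. -/
lemma exists_joint_eigenvector (S : Set (End ℂ M)) (hS : ∀ f ∈ S, ∀ g ∈ S, f * g = g * f)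
    (V : Submodule ℂ M) [FiniteDimensional ℂ V] (hV : V ≠ ⊥) (hSV : ∀ f ∈ S, ∀ v ∈ V, f v ∈ V) :
    ∃ v ∈ V, v ≠ 0 ∧ ∀ f ∈ S, ∃ c : ℂ, f v = c • v := by
  induction hd : finrank ℂ V using Nat.strong_induction_on generalizing V with
  | _ d ih =>
    by_cases hsc : ∀ f ∈ S, ∃ c : ℂ, ∀ v ∈ V, f v = c • v
    · obtain ⟨v, hv, hv0⟩ := (Submodule.ne_bot_iff _).1 hV
      exact ⟨v, hv, hv0, fun f hf ↦ (hsc f hf).imp fun c hc ↦ hc v hv⟩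
    · push Not at hsc
      obtain ⟨f, hf, hfV⟩ := hsc
      have := Submodule.nontrivial_iff_ne_bot.2 hV
      obtain ⟨c, hc⟩ := Module.End.exists_eigenvalue (f.restrict (hSV f hf))
      obtain ⟨w, hw⟩ := hc.exists_hasEigenvector
      have hwe : f w = c • (w : M) := congrArg Subtype.val hw.apply_eq_smul
      have hlt : V ⊓ f.eigenspace c < V := by
        refine inf_le_left.lt_of_ne fun heq ↦ ?_
        obtain ⟨v, hv, hvc⟩ := hfV c
        rw [← heq] at hv
        exact hvc (Module.End.mem_eigenspace_iff.1 hv.2)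
      have hfd : FiniteDimensional ℂ (V ⊓ f.eigenspace c : Submodule ℂ M) :=
        Submodule.finiteDimensional_of_le hlt.le
      obtain ⟨v, hv, hv'⟩ := ih _ (hd ▸ Submodule.finrank_lt_finrank_of_lt hlt)
        (V ⊓ f.eigenspace c)
        ((Submodule.ne_bot_iff _).2
          ⟨w, ⟨w.2, Module.End.mem_eigenspace_iff.2 hwe⟩, by simpa using hw.2⟩)
        (fun g hg v hv ↦
          ⟨hSV g hg v hv.1, apply_mem_eigenspace_of_commute (hS g hg f hf) hv.2⟩) rfl
      exact ⟨v, hv.1, hv'⟩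

end Representation

section RootSystem

variable {𝕘} [FiniteDimensional ℂ 𝕘] [LieAlgebra.IsKilling ℂ 𝕘]
  (H : LieSubalgebra ℂ 𝕘) [H.IsCartanSubalgebra]

lemma rootSp_eq_rootSpace (χ : H → ℂ) :
    rootSp H χ = (LieAlgebra.rootSpace H χ).toSubmodule := by
  ext x
  refine ⟨fun hx ↦ ?_, fun hx h ↦ LieAlgebra.IsKilling.lie_eq_smul_of_mem_rootSpace hx h⟩
  exact LieModule.weightSpace_le_genWeightSpace 𝕘 χ ((LieModule.mem_weightSpace χ x).2 hx)

variable {H} in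
lemma exists_weight_of_rootSp_ne_bot {χ : H → ℂ} (hχ : rootSp H χ ≠ ⊥) :
    ∃ α : LieModule.Weight ℂ H 𝕘, ⇑α = χ := by
  rw [rootSp_eq_rootSpace] at hχ
  exact ⟨⟨χ, fun h0 ↦ hχ (by simp [LieAlgebra.rootSpace, h0])⟩, rfl⟩

variable {H} in
lemma rootSp_neg_ne_bot {χ : H → ℂ} (hχ : rootSp H χ ≠ ⊥) : rootSp H (-χ) ≠ ⊥ := by
  obtain ⟨α, rfl⟩ := exists_weight_of_rootSp_ne_bot hχ
  rw [rootSp_eq_rootSpace, ← LieModule.Weight.coe_neg]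
  simpa using (-α).genWeightSpace_ne_bot

/-- The roots with positive real part at a suitable element form a positive system. -/
lemma exists_isPositiveSystem :
    ∃ h₀ : H, IsPositiveSystem H {χ | rootSp H χ ≠ ⊥ ∧ 0 < (χ h₀).re} := by
  let f (α : {α : LieModule.Weight ℂ H 𝕘 // α.IsNonZero}) : Module.Dual ℝ H :=
    Complex.reLm ∘ₗ ((LieModule.Weight.toLinear ℂ H 𝕘 α.1).restrictScalars ℝ)
  have hf (α) : ∃ x, f α x ≠ 0 := by
    obtain ⟨x, hx⟩ : ∃ x, α.1 x ≠ 0 := Function.ne_iff.1 α.2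
    by_cases hre : (α.1 x).re = 0
    · refine ⟨Complex.I • x, ?_⟩
      have him : (α.1 x).im ≠ 0 := fun him ↦ hx (Complex.ext hre him)
      have : LieModule.Weight.toLinear ℂ H 𝕘 α.1 (Complex.I • x) = Complex.I * α.1 x := by
        simp
      simpa [f, this] using him
    · exact ⟨x, by simpa [f] using hre⟩
  obtain ⟨h₀, hh₀⟩ := Module.Dual.exists_forall_ne_zero_of_forall_exists f hf
  refine ⟨h₀, ?_, ?_, ?_⟩
  · rintro χ ⟨hχ, hpos⟩
    exact ⟨fun h0 ↦ by simp [h0] at hpos, hχ⟩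
  · intro χ hχ0 hχ
    obtain ⟨α, rfl⟩ := exists_weight_of_rootSp_ne_bot hχ
    have hne : (α h₀).re ≠ 0 := by simpa [f] using hh₀ ⟨α, hχ0⟩
    simp only [Set.mem_ofPred_eq, Pi.neg_apply, Complex.neg_re]
    refine ⟨?_, fun hh ↦ by linarith [hh.1.2, hh.2.2]⟩
    rcases lt_or_gt_of_ne hne with hlt | hgt
    · exact .inr ⟨rootSp_neg_ne_bot hχ, by linarith⟩
    · exact .inl ⟨hχ, hgt⟩
  · rintro χ ψ ⟨-, hχ⟩ ⟨-, hψ⟩ hs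
    exact ⟨hs, by simpa using add_pos hχ hψ⟩

variable {H} in
lemma IsPositiveSystem.neg {P : Set (H → ℂ)} (hP : IsPositiveSystem H P) :
    IsPositiveSystem H {χ | -χ ∈ P} := by
  refine ⟨fun χ hχ ↦ ?_, fun χ h0 hχ ↦ ?_, fun χ ψ hχ hψ hs ↦ ?_⟩
  · obtain ⟨h1, h2⟩ := hP.1 _ hχ
    exact ⟨neg_ne_zero.1 h1, by simpa using rootSp_neg_ne_bot h2⟩
  · obtain ⟨h1, h2⟩ := hP.2.1 χ h0 hχ
    simp only [Set.mem_ofPred_eq, neg_neg]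
    exact ⟨h1.symm, fun hh ↦ h2 hh.symm⟩
  · have := rootSp_neg_ne_bot hs
    rw [neg_add] at this
    show -(χ + ψ) ∈ P
    rw [neg_add]
    exact hP.2.2 _ _ hχ hψ this

end RootSystem

section HighestWeight

variable {𝕘} {M : Type} [AddCommGroup M] [Module ℂ M]
  {Φ : 𝕘 →ₗ[ℂ] 𝕘 →ₗ[ℂ] ℂ} {L G : ℤ → End ℂ M} {C C1 : End ℂ M}
  {E F : ℤ → 𝕘 →ₗ[ℂ] End ℂ M}

/-- The homogeneous weight vectors of a given weight and parity killed in all positive degrees. -/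
def singularSpace (L G : ℤ → End ℂ M) (E F : ℤ → 𝕘 →ₗ[ℂ] End ℂ M)
    (gr : Fin 2 → Submodule ℂ M) (μ : ℂ) (p : Fin 2) : Submodule ℂ M :=
  (L 0).eigenspace μ ⊓ gr p ⊓
    ⨅ (n : ℤ) (_ : 0 < n) (a : SCCGen 𝕘), LinearMap.ker (sccOp L G E F a n)

lemma mem_singularSpace {gr : Fin 2 → Submodule ℂ M} {μ : ℂ} {p : Fin 2} {v : M} :
    v ∈ singularSpace L G E F gr μ p ↔
      (v ∈ (L 0).eigenspace μ ∧ v ∈ gr p) ∧ KilledAbove L G E F 0 v := by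
  simp [singularSpace, KilledAbove, Submodule.mem_iInf]

lemma exists_singularSpace_ne_bot {gr : Fin 2 → Submodule ℂ M}
    (hsuper : IsSCCSuper 𝕘 gr L G C C1 E F) {μ : ℂ} {v : M} (hμ : v ∈ (L 0).eigenspace μ)
    (hv0 : v ≠ 0) (hv : KilledAbove L G E F 0 v) :
    ∃ p, singularSpace L G E F gr μ p ≠ ⊥ := by
  obtain ⟨v₀, h₀, v₁, h₁, rfl⟩ := exists_add_of_isInternal hsuper.internal v
  obtain ⟨e₀, e₁⟩ := mem_eigenspace_of_add_mem hsuper.internal (hsuper.hL 0) h₀ h₁ hμ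
  have hk : ∀ n, 0 < n → ∀ a, sccOp L G E F a n v₀ = 0 ∧ sccOp L G E F a n v₁ = 0 := by
    intro n hn a
    obtain ⟨p, hp⟩ := hsuper.exists_mapsGr_op a n
    exact hp.apply_eq_zero_of_add hsuper.internal h₀ h₁ (hv n hn a)
  by_cases hz : v₀ = 0
  · exact ⟨1, (Submodule.ne_bot_iff _).2 ⟨v₁, mem_singularSpace.2
      ⟨⟨e₁, h₁⟩, fun n hn a ↦ (hk n hn a).2⟩, by simpa [hz] using hv0⟩⟩
  · exact ⟨0, (Submodule.ne_bot_iff _).2 ⟨v₀, mem_singularSpace.2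
      ⟨⟨e₀, h₀⟩, fun n hn a ↦ (hk n hn a).1⟩, hz⟩⟩

lemma E_zero_mem_singularSpace (h : IsSCCRep 𝕘 Φ L G C C1 E F) {gr : Fin 2 → Submodule ℂ M}
    (hsuper : IsSCCSuper 𝕘 gr L G C C1 E F) {μ : ℂ} {p : Fin 2} {v : M}
    (hv : v ∈ singularSpace L G E F gr μ p) (x : 𝕘) :
    E 0 x v ∈ singularSpace L G E F gr μ p := by
  obtain ⟨⟨hμ, hp⟩, hk⟩ := mem_singularSpace.1 hv
  refine mem_singularSpace.2 ⟨⟨?_, ?_⟩, hk.op h le_rfl (.even x) le_rfl⟩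
  · simpa [sccOp] using h.op_mem_eigenspace (.even x) 0 hμ
  · simpa using hsuper.hE 0 x p (Submodule.mem_map_of_mem hp)

lemma central_mem_singularSpace {gr : Fin 2 → Submodule ℂ M} {Z : End ℂ M}
    (hL : Z * L 0 = L 0 * Z) (hZ : MapsGr gr 0 Z)
    (hop : ∀ a i, Z * sccOp L G E F a i = sccOp L G E F a i * Z) {μ : ℂ} {p : Fin 2} {v : M}
    (hv : v ∈ singularSpace L G E F gr μ p) : Z v ∈ singularSpace L G E F gr μ p := by
  obtain ⟨⟨hμ, hp⟩, hk⟩ := mem_singularSpace.1 hv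
  refine mem_singularSpace.2 ⟨⟨apply_mem_eigenspace_of_commute hL hμ, ?_⟩, fun n hn a ↦ ?_⟩
  · simpa using hZ p (Submodule.mem_map_of_mem hp)
  · have := LinearMap.congr_fun (hop a n) v
    rw [Module.End.mul_apply, Module.End.mul_apply, hk n hn a, map_zero] at this
    exact this.symm

/-- A simple Harish-Chandra module containing a weight vector killed by all generators of large
degree is a highest weight module. -/
lemma isHighestWeight_of_killedAbove [FiniteDimensional ℂ 𝕘] [LieAlgebra.IsKilling ℂ 𝕘]
    (h : IsSCCRep 𝕘 Φ L G C C1 E F) {gr : Fin 2 → Submodule ℂ M}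
    (hsuper : IsSCCSuper 𝕘 gr L G C C1 E F)
    (hsimple : IsSimpleRep (sccOps 𝕘 L G C C1 E F) gr)
    (hfd : ∀ μ, FiniteDimensional ℂ ((L 0).eigenspace μ)) (N : ℕ)
    (hN : ∃ μ, ∃ v ∈ (L 0).eigenspace μ, v ≠ 0 ∧ KilledAbove L G E F N v) :
    IsHighestWeight 𝕘 L G C C1 E F := by
  obtain ⟨μ, v₁, hμ, hv₁, hk⟩ := exists_killedAbove_zero h hfd N hN
  obtain ⟨p, hp⟩ := exists_singularSpace_ne_bot hsuper hμ hv₁ hk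
  set V := singularSpace L G E F gr μ p with hV
  have := hfd μ
  have hVfd : FiniteDimensional ℂ V :=
    Submodule.finiteDimensional_of_le (inf_le_left.trans inf_le_left : V ≤ (L 0).eigenspace μ)
  obtain ⟨x₀, hx₀⟩ := LieAlgebra.exists_isCartanSubalgebra_engel ℂ 𝕘
  set H := LieSubalgebra.engel ℂ x₀
  obtain ⟨h₀, hP⟩ := exists_isPositiveSystem H
  have hCop : ∀ a i, C * sccOp L G E F a i = sccOp L G E F a i * C := by
    rintro (_ | _ | x | x) i
    exacts [h.central_C_L i, h.central_C_G i, h.central_C_E i x, h.central_C_F i x]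
  have hC1op : ∀ a i, C1 * sccOp L G E F a i = sccOp L G E F a i * C1 := by
    rintro (_ | _ | x | x) i
    exacts [h.central_C1_L i, h.central_C1_G i, h.central_C1_E i x, h.central_C1_F i x]
  have hEE (x y : 𝕘) : E 0 x * E 0 y = E 0 y * E 0 x + E 0 ⁅x, y⁆ := by
    have := h.comm_EE 0 0 x y
    exact sub_eq_iff_eq_add'.1 (by simpa using this)
  let S : Set (End ℂ M) := {f | f = C ∨ f = C1 ∨ ∃ y : H, f = E 0 y}
  have hHcomm (y z : H) : ⁅(y : 𝕘), (z : 𝕘)⁆ = 0 :=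
    congrArg Subtype.val (trivial_lie_zero H H y z)
  have hS : ∀ f ∈ S, ∀ g ∈ S, f * g = g * f := by
    rintro f (rfl | rfl | ⟨y, rfl⟩) g (rfl | rfl | ⟨z, rfl⟩)
    · rfl
    · exact h.central_C_C1
    · exact h.central_C_E 0 _
    · exact h.central_C_C1.symm
    · rfl
    · exact h.central_C1_E 0 _
    · exact (h.central_C_E 0 _).symm
    · exact (h.central_C1_E 0 _).symm
    · rw [hEE, hHcomm, map_zero, add_zero]
  have hSV : ∀ f ∈ S, ∀ v ∈ V, f v ∈ V := by
    rintro f (rfl | rfl | ⟨y, rfl⟩) v hv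
    · exact central_mem_singularSpace (h.central_C_L 0) hsuper.hC hCop hv
    · exact central_mem_singularSpace (h.central_C1_L 0) hsuper.hC1 hC1op hv
    · exact E_zero_mem_singularSpace h hsuper hv _
  let X : Set M := {v | v ∈ V ∧ v ≠ 0 ∧ ∀ f ∈ S, ∃ c : ℂ, f v = c • v}
  let T : Set ℂ := {c | ∃ v ∈ X, E 0 h₀ v = c • v}
  have hTfin : T.Finite := by
    refine (Module.End.finite_hasEigenvalue
      ((E 0 (h₀ : 𝕘)).restrict (hSV _ (.inr (.inr ⟨h₀, rfl⟩))))).subset ?_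
    rintro c ⟨v, ⟨hvV, hv0, -⟩, hc⟩
    refine Module.End.hasEigenvalue_of_hasEigenvector (x := ⟨v, hvV⟩) ⟨?_, ?_⟩
    · exact Module.End.mem_eigenspace_iff.2 (Subtype.ext hc)
    · simpa using hv0
  have hTne : T.Nonempty := by
    obtain ⟨v, hv⟩ := exists_joint_eigenvector S hS V hp hSV
    obtain ⟨c, hc⟩ := hv.2.2 _ (.inr (.inr ⟨h₀, rfl⟩))
    exact ⟨c, v, hv, hc⟩
  obtain ⟨c₀, ⟨v, ⟨hvV, hv0, hvS⟩, hc₀⟩, hmax⟩ := Set.exists_max_image T Complex.re hTfin hTne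
  obtain ⟨⟨hvμ, hvp⟩, hvk⟩ := mem_singularSpace.1 hvV
  refine ⟨H, hx₀, _, hP, v, hv0, ?_, ?_, fun y ↦ hvS _ (.inr (.inr ⟨y, rfl⟩)),
    ⟨μ, Module.End.mem_eigenspace_iff.1 hvμ⟩, hvS _ (.inl rfl), hvS _ (.inr (.inl rfl)),
    fun N hN hvN ↦ hsimple.eq_top_of_mem hsuper hv0 hvp hN hvN⟩
  · exact fun i hi ↦ ⟨hvk i hi .vir, hvk i hi .ns, fun x ↦ ⟨hvk i hi (.even x), hvk i hi (.odd x)⟩⟩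
  · rintro χ ⟨-, hχ⟩ x hx
    by_contra hu0
    have hE (y : H) {c : ℂ} (hc : E 0 y v = c • v) :
        E 0 y (E 0 x v) = (c + χ y) • E 0 x v := by
      have := LinearMap.congr_fun (hEE y x) v
      rw [hx y] at this
      simpa [hc, add_smul] using this
    have hZ {Z : End ℂ M} (hZx : Z * E 0 x = E 0 x * Z) (hZS : Z ∈ S) :
        ∃ c : ℂ, Z (E 0 x v) = c • E 0 x v := by
      obtain ⟨c, hc⟩ := hvS Z hZS
      refine ⟨c, ?_⟩
      have := LinearMap.congr_fun hZx v
      rwa [Module.End.mul_apply, Module.End.mul_apply, hc, map_smul] at this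
    have hX : E 0 x v ∈ X := by
      refine ⟨E_zero_mem_singularSpace h hsuper hvV x, hu0, ?_⟩
      rintro f (rfl | rfl | ⟨y, rfl⟩)
      · exact hZ (h.central_C_E 0 x) (.inl rfl)
      · exact hZ (h.central_C1_E 0 x) (.inr (.inl rfl))
      · obtain ⟨c, hc⟩ := hvS _ (.inr (.inr ⟨y, rfl⟩))
        exact ⟨_, hE y hc⟩
    have := hmax _ ⟨_, hX, hE h₀ hc₀⟩
    rw [Complex.add_re] at this
    linarith

/-- Reversing the sign of all degrees gives another representation. -/
lemma IsSCCRep.reverse (h : IsSCCRep 𝕘 Φ L G C C1 E F) :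
    IsSCCRep 𝕘 Φ (fun i ↦ -L (-i)) (fun i ↦ Complex.I • G (-i)) (-C) (-C1)
      (fun i ↦ E (-i)) (fun i ↦ -Complex.I • F (-i)) where
  comm_LL i j := by
    have := h.comm_LL (-i) (-j)
    rw [show -i + -j = -(i + j) by ring] at this
    simp only [neg_mul_neg, this, neg_eq_zero]
    split_ifs <;> push_cast <;> module
  comm_LG i j := by
    have := h.comm_LG (-i) (-j)
    rw [show -i + -j = -(i + j) by ring] at this
    rw [neg_mul, mul_neg, smul_mul_assoc, mul_smul_comm, neg_sub_neg, ← smul_sub,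
      ← neg_sub, this]
    push_cast; module
  comm_GG i j := by
    have := h.comm_GG (-i) (-j)
    rw [show -i + -j = -(i + j) by ring] at this
    simp only [smul_mul_smul_comm, Complex.I_mul_I, ← smul_add, this, neg_eq_zero]
    split_ifs <;> push_cast <;> module
  comm_LE i j x := by
    have := h.comm_LE (-i) (-j) x
    rw [show -i + -j = -(i + j) by ring] at this
    rw [neg_mul, mul_neg, neg_sub_neg, ← neg_sub, this]
    push_cast; module
  comm_LF i j x := by
    have := h.comm_LF (-i) (-j) x
    rw [show -i + -j = -(i + j) by ring] at this
    simp only [LinearMap.smul_apply]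
    rw [neg_mul, mul_neg, smul_mul_assoc, mul_smul_comm, neg_sub_neg, ← smul_sub,
      ← neg_sub, this]
    push_cast; module
  comm_GE i j x := by
    have := h.comm_GE (-i) (-j) x
    rw [show -i + -j = -(i + j) by ring] at this
    simp only [LinearMap.smul_apply]
    rw [smul_mul_assoc, mul_smul_comm, ← smul_sub, this]
    push_cast; module
  comm_GF i j x := by
    have := h.comm_GF (-i) (-j) x
    rw [show -i + -j = -(i + j) by ring] at this
    simp only [LinearMap.smul_apply, smul_mul_smul_comm, mul_neg, neg_mul, Complex.I_mul_I,
      neg_neg, one_smul, this]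
  comm_EE i j x y := by
    have := h.comm_EE (-i) (-j) x y
    rw [show -i + -j = -(i + j) by ring] at this
    simp only [this, neg_eq_zero]
    split_ifs <;> push_cast <;> module
  comm_FE i j x y := by
    have := h.comm_FE (-i) (-j) x y
    rw [show -i + -j = -(i + j) by ring] at this
    simp only [LinearMap.smul_apply, smul_mul_assoc, mul_smul_comm, ← smul_sub, this]
  comm_FF i j x y := by
    have := h.comm_FF (-i) (-j) x y
    rw [show -i + -j = -(i + j) by ring] at this
    simp only [LinearMap.smul_apply, smul_mul_smul_comm, mul_neg, neg_mul, Complex.I_mul_I,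
      neg_neg, neg_smul, one_smul, ← neg_add, this, neg_eq_zero, smul_neg]
  central_C_L i := by simp [h.central_C_L]
  central_C_G i := by simp [h.central_C_G]
  central_C_E i x := by simp [h.central_C_E]
  central_C_F i x := by simp [h.central_C_F]
  central_C_C1 := by simp [h.central_C_C1]
  central_C1_L i := by simp [h.central_C1_L]
  central_C1_G i := by simp [h.central_C1_G]
  central_C1_E i x := by simp [h.central_C1_E]
  central_C1_F i x := by simp [h.central_C1_F]

lemma MapsGr.smul {gr : Fin 2 → Submodule ℂ M} {p : Fin 2} {f : End ℂ M} (hf : MapsGr gr p f)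
    (c : ℂ) : MapsGr gr p (c • f) := by
  rintro q _ ⟨v, hv, rfl⟩
  exact (gr (q + p)).smul_mem c (hf q (Submodule.mem_map_of_mem hv))

lemma MapsGr.neg {gr : Fin 2 → Submodule ℂ M} {p : Fin 2} {f : End ℂ M} (hf : MapsGr gr p f) :
    MapsGr gr p (-f) := by
  simpa using hf.smul (-1)

lemma IsSCCSuper.reverse {gr : Fin 2 → Submodule ℂ M}
    (h : IsSCCSuper 𝕘 gr L G C C1 E F) :
    IsSCCSuper 𝕘 gr (fun i ↦ -L (-i)) (fun i ↦ Complex.I • G (-i)) (-C) (-C1)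
      (fun i ↦ E (-i)) (fun i ↦ -Complex.I • F (-i)) where
  internal := h.internal
  hL _ := (h.hL _).neg
  hG _ := (h.hG _).smul _
  hC := h.hC.neg
  hC1 := h.hC1.neg
  hE _ x := h.hE _ x
  hF _ x := (h.hF _ x).smul _

/-- Generators of the reversed representation are nonzero multiples of the original ones. -/
lemma exists_sccOp_reverse (a : SCCGen 𝕘) (i : ℤ) : ∃ c : ℂ, c ≠ 0 ∧
    sccOp (fun i ↦ -L (-i)) (fun i ↦ Complex.I • G (-i)) (fun i ↦ E (-i))
      (fun i ↦ -Complex.I • F (-i)) a i = c • sccOp L G E F a (-i) := by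
  rcases a with _ | _ | x | x
  · exact ⟨-1, by simp, by simp [sccOp]⟩
  · exact ⟨Complex.I, Complex.I_ne_zero, rfl⟩
  · exact ⟨1, one_ne_zero, by simp [sccOp]⟩
  · exact ⟨-Complex.I, neg_ne_zero.2 Complex.I_ne_zero, rfl⟩

lemma invariantUnder_sccOps_iff {N : Submodule ℂ M} :
    InvariantUnder (sccOps 𝕘 L G C C1 E F) N ↔
      (∀ a i, ∀ v ∈ N, sccOp L G E F a i v ∈ N) ∧ (∀ v ∈ N, C v ∈ N) ∧ ∀ v ∈ N, C1 v ∈ N := by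
  refine ⟨fun h ↦ ⟨fun a i v hv ↦ ?_, fun v hv ↦ ?_, fun v hv ↦ ?_⟩, fun h f hf ↦ ?_⟩
  · refine h _ ?_ (Submodule.mem_map_of_mem hv)
    rcases a with _ | _ | x | x
    exacts [.inl (.inl (.inl (.inl ⟨i, rfl⟩))), .inl (.inl (.inl (.inr ⟨i, rfl⟩))),
      .inl (.inr ⟨i, x, rfl⟩), .inr ⟨i, x, rfl⟩]
  · exact h C (.inl (.inl (.inr (.inl rfl)))) (Submodule.mem_map_of_mem hv)
  · exact h C1 (.inl (.inl (.inr (.inr rfl)))) (Submodule.mem_map_of_mem hv)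
  · rintro _ ⟨v, hv, rfl⟩
    rcases eq_sccOp_or_of_mem_sccOps hf with ⟨a, i, rfl⟩ | rfl | rfl
    exacts [h.1 a i v hv, h.2.1 v hv, h.2.2 v hv]

lemma InvariantUnder.iff_reverse {N : Submodule ℂ M} :
    InvariantUnder (sccOps 𝕘 (fun i ↦ -L (-i)) (fun i ↦ Complex.I • G (-i)) (-C) (-C1)
      (fun i ↦ E (-i)) (fun i ↦ -Complex.I • F (-i))) N
      ↔ InvariantUnder (sccOps 𝕘 L G C C1 E F) N := by
  simp only [invariantUnder_sccOps_iff, LinearMap.neg_apply, neg_mem_iff]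
  refine and_congr ⟨fun h a i v hv ↦ ?_, fun h a i v hv ↦ ?_⟩ Iff.rfl
  · obtain ⟨c, hc, he⟩ := exists_sccOp_reverse (L := L) (G := G) (E := E) (F := F) a (-i)
    have := h a (-i) v hv
    rwa [he, neg_neg, LinearMap.smul_apply, Submodule.smul_mem_iff _ hc] at this
  · obtain ⟨c, -, he⟩ := exists_sccOp_reverse (L := L) (G := G) (E := E) (F := F) a i
    rw [he]
    exact N.smul_mem c (h a (-i) v hv)

lemma sccOp_reverse_apply_eq_zero {a : SCCGen 𝕘} {i : ℤ} {v : M}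
    (hv : sccOp L G E F a (-i) v = 0) :
    sccOp (fun i ↦ -L (-i)) (fun i ↦ Complex.I • G (-i)) (fun i ↦ E (-i))
      (fun i ↦ -Complex.I • F (-i)) a i v = 0 := by
  obtain ⟨c, -, he⟩ := exists_sccOp_reverse (L := L) (G := G) (E := E) (F := F) a i
  rw [he, LinearMap.smul_apply, hv, smul_zero]

lemma eigenspace_neg (f : End ℂ M) (μ : ℂ) : (-f).eigenspace μ = f.eigenspace (-μ) := by
  ext v
  simp only [Module.End.mem_eigenspace_iff, LinearMap.neg_apply, neg_smul]
  exact neg_eq_iff_eq_neg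

/-- A highest weight module for the reversed representation is a lowest weight module. -/
lemma IsHighestWeight.isLowestWeight_of_reverse [FiniteDimensional ℂ 𝕘]
    [LieAlgebra.IsKilling ℂ 𝕘]
    (h : IsHighestWeight 𝕘 (fun i ↦ -L (-i)) (fun i ↦ Complex.I • G (-i)) (-C) (-C1)
      (fun i ↦ E (-i)) (fun i ↦ -Complex.I • F (-i))) :
    IsLowestWeight 𝕘 L G C C1 E F := by
  obtain ⟨H, hH, P, hP, v, hv0, hpos, hroot, hE, ⟨a, ha⟩, ⟨b, hb⟩, ⟨c, hc⟩, hgen⟩ := h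
  have hneg {f : End ℂ M} {c : ℂ} (hf : (-f) v = c • v) : ∃ c : ℂ, f v = c • v :=
    ⟨-c, by rw [neg_smul, ← hf, LinearMap.neg_apply, neg_neg]⟩
  refine ⟨H, hH, _, hP.neg, v, hv0, fun i hi ↦ ?_, fun χ hχ x hx ↦ ?_, by simpa using hE,
    hneg (by simpa using ha), hneg hb, hneg hc,
    fun N hN ↦ hgen N (InvariantUnder.iff_reverse.2 hN)⟩
  · simpa [Complex.I_ne_zero, forall_and] using hpos (-i) (by lia)
  · simpa using hroot (-χ) hχ x hx

end HighestWeight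

/-- Suppose `M` is a simple Harish-Chandra module over the
superconformal current algebra `ĝ` which is not cuspidal.  Then `M` is a highest
weight module or a lowest weight module. -/
theorem simple_HC_not_cuspidal_is_highest_or_lowest
    (𝕘 : Type) [LieRing 𝕘] [LieAlgebra ℂ 𝕘] [FiniteDimensional ℂ 𝕘]
    [LieAlgebra.IsSimple ℂ 𝕘]
    (Φ : 𝕘 →ₗ[ℂ] 𝕘 →ₗ[ℂ] ℂ)
    (hΦsymm : ∀ x y : 𝕘, Φ x y = Φ y x)
    (hΦinv : ∀ x y z : 𝕘, Φ ⁅x, y⁆ z = Φ x ⁅y, z⁆)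
    (hΦnd : ∀ x : 𝕘, (∀ y : 𝕘, Φ x y = 0) → x = 0)
    (M : Type) [AddCommGroup M] [Module ℂ M]
    (L G : ℤ → End ℂ M) (C C1 : End ℂ M)
    (E F : ℤ → 𝕘 →ₗ[ℂ] End ℂ M)
    (gr : Fin 2 → Submodule ℂ M)
    (hrep : IsSCCRep 𝕘 Φ L G C C1 E F)
    (hsuper : IsSCCSuper 𝕘 gr L G C C1 E F)
    (hsimple : IsSimpleRep (sccOps 𝕘 L G C C1 E F) gr)
    (hHC : IsHarishChandra (L 0))
    (hnotcusp : ¬ IsCuspidalMod (L 0)) :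
    IsHighestWeight 𝕘 L G C C1 E F ∨ IsLowestWeight 𝕘 L G C C1 E F := by
  obtain ⟨μ, v, hμ, hv0, k, hk, ⟨h1, h2⟩ | ⟨h1, h2⟩⟩ :=
    exists_killed_consecutive hrep hsuper hsimple hHC hnotcusp
  · obtain ⟨N, hN⟩ := hrep.exists_killedAbove hk h1 h2
    exact .inl (isHighestWeight_of_killedAbove hrep hsuper hsimple hHC.2 N ⟨μ, v, hμ, hv0, hN⟩)
  · obtain ⟨N, hN⟩ := hrep.reverse.exists_killedAbove hk
      (fun a ↦ sccOp_reverse_apply_eq_zero (h1 a)) (fun a ↦ sccOp_reverse_apply_eq_zero (h2 a))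
    refine .inr (isHighestWeight_of_killedAbove hrep.reverse hsuper.reverse
      ⟨hsimple.1, fun N hN ↦ hsimple.2 N (InvariantUnder.iff_reverse.1 hN)⟩ (fun ν ↦ ?_) N
      ⟨-μ, v, ?_, hv0, hN⟩).isLowestWeight_of_reverse
    · rw [neg_zero, eigenspace_neg]
      exact hHC.2 _
    · rw [neg_zero, eigenspace_neg, neg_neg]
      exact hμ
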